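/- Let ν be a shift-invariant ergodic probability measure on {r,s}^ℤ such that ν-almost surely no two s-labels are within distance 2 of each other (for every x, not both ζ(x) = s and ζ(x+1) = s, and not both ζ(x) = s and ζ(x+2) = s), and assume ν(ζ(0) = s) > 0. Write f_r = ν(ζ(0) = r). Define the transition density ρ_tr = sup{ρ > 0 : the pair (η, ζ) is (μ_ρ ⊗ ν)-almost surely stabilizable}. Then ρ_tr equals the unique positive solution ρ of the equation ρ − (1/2)(1 − e^{−2ρ}) = ((1 − f_r)/2)(1 + e^{−2ρ})². -/

import Mathlib

open MeasureTheory Filter Topology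

/-- Toppling labels: `r` (both particles to the right neighbor) and
`s` (one particle to each neighbor). -/
inductive Label : Type
  | r : Label
  | s : Label
deriving DecidableEq

instance : MeasurableSpace Label := ⊤

/-- One step of the quenched parallel toppling dynamics on `ℤ` in environment `ζ`:
every unstable site (height `≥ 2`) topples, losing two particles which go both to
the right neighbor if its label is `r`, or one to each neighbor if its label is `s`. -/
def parStep (ζ : ℤ → Label) (η : ℤ → ℕ) : ℤ → ℕ := fun x =>
  (η x - if 2 ≤ η x then 2 else 0)
    + (if 2 ≤ η (x - 1) ∧ ζ (x - 1) = Label.r then 2 else 0)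
    + (if 2 ≤ η (x - 1) ∧ ζ (x - 1) = Label.s then 1 else 0)
    + (if 2 ≤ η (x + 1) ∧ ζ (x + 1) = Label.s then 1 else 0)

/-- `(η, ζ)` is stabilizable if every site is eventually stable forever under
the parallel toppling dynamics. -/
def Stabilizable (η : ℤ → ℕ) (ζ : ℤ → Label) : Prop :=
  ∀ x : ℤ, ∃ T : ℕ, ∀ t : ℕ, T ≤ t → ((parStep ζ)^[t] η) x ≤ 1

namespace Sandpile

/-- The number of particles a site receives when every site `x` topples `u x` times. -/
def inflow (ζ : ℤ → Label) (u : ℤ → ℕ) (x : ℤ) : ℕ :=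
  (if ζ (x - 1) = Label.r then 2 * u (x - 1) else u (x - 1))
    + (if ζ (x + 1) = Label.s then u (x + 1) else 0)

/-- Toppling every site `x` exactly `u x` times leaves at most one particle everywhere. -/
def IsStabilizing (η : ℤ → ℕ) (ζ : ℤ → Label) (u : ℤ → ℕ) : Prop :=
  ∀ x, η x + inflow ζ u x ≤ 2 * u x + 1

/-- The number of topplings at each site during the first `t` steps. -/
def odometer (ζ : ℤ → Label) (η : ℤ → ℕ) : ℕ → ℤ → ℕ
  | 0, _ => 0
  | t + 1, x => odometer ζ η t x + if 2 ≤ (parStep ζ)^[t] η x then 1 else 0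

lemma label_cases (l : Label) : l = Label.r ∨ l = Label.s := by
  cases l <;> simp

lemma iterate_add_two_mul_odometer (ζ : ℤ → Label) (η : ℤ → ℕ) (t : ℕ) (x : ℤ) :
    (parStep ζ)^[t] η x + 2 * odometer ζ η t x = η x + inflow ζ (odometer ζ η t) x := by
  induction t generalizing x with
  | zero => simp [odometer, inflow]
  | succ t ih =>
    have h := ih x
    rw [Function.iterate_succ_apply']
    simp only [odometer, inflow, parStep] at h ⊢
    rcases label_cases (ζ (x - 1)) with h1 | h1 <;> rcases label_cases (ζ (x + 1)) with h2 | h2 <;>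
      simp only [h1, h2, and_true, and_false, if_true, if_false, reduceCtorEq] at h ⊢ <;>
      split_ifs <;> omega

lemma inflow_mono {ζ : ℤ → Label} {u v : ℤ → ℕ} (h : ∀ x, u x ≤ v x) (x : ℤ) :
    inflow ζ u x ≤ inflow ζ v x := by
  have h1 := h (x - 1)
  have h2 := h (x + 1)
  unfold inflow
  split_ifs <;> omega

lemma odometer_le {η : ℤ → ℕ} {ζ : ℤ → Label} {u : ℤ → ℕ} (hu : IsStabilizing η ζ u) (t : ℕ)
    (x : ℤ) : odometer ζ η t x ≤ u x := by
  induction t generalizing x with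
  | zero => simp [odometer]
  | succ t ih =>
    have h := iterate_add_two_mul_odometer ζ η t x
    have h1 := inflow_mono (ζ := ζ) ih x
    have h2 := hu x
    have h3 := ih x
    simp only [odometer]
    split_ifs <;> omega

lemma odometer_mono (ζ : ℤ → Label) (η : ℤ → ℕ) (x : ℤ) :
    Monotone fun t => odometer ζ η t x :=
  monotone_nat_of_le_succ fun t => by simp [odometer]

lemma stabilizable_iff_exists_isStabilizing (η : ℤ → ℕ) (ζ : ℤ → Label) :
    Stabilizable η ζ ↔ ∃ u, IsStabilizing η ζ u := by
  constructor
  · intro h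
    choose T hT using h
    have hconst : ∀ x t, T x ≤ t → odometer ζ η t x = odometer ζ η (T x) x := by
      intro x t ht
      induction t, ht using Nat.le_induction with
      | base => rfl
      | succ t ht ih =>
        have := hT x t ht
        simp only [odometer]
        rw [if_neg (by omega), ih, add_zero]
    refine ⟨fun x => odometer ζ η (T x) x, fun x => ?_⟩
    set t := T (x - 1) + T x + T (x + 1) with ht
    have h := iterate_add_two_mul_odometer ζ η t x
    have h1 := hT x t (by omega)
    simp only [inflow] at h ⊢
    rw [hconst (x - 1) t (by omega), hconst x t (by omega), hconst (x + 1) t (by omega)] at h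
    omega
  · rintro ⟨u, hu⟩ x
    let T := Function.argmin fun t => u x - odometer ζ η t x
    refine ⟨T, fun t ht => ?_⟩
    by_contra! hlt
    have h1 : u x - odometer ζ η T x ≤ u x - odometer ζ η (t + 1) x :=
      Function.argmin_le (fun t => u x - odometer ζ η t x) (t + 1)
    have h2 : odometer ζ η T x ≤ odometer ζ η t x := odometer_mono ζ η x ht
    have h3 := odometer_le hu (t + 1) x
    simp only [odometer] at h1 h3
    rw [if_pos (by omega)] at h1 h3
    omega

/-- The net number of pairs of particles gained by the rightward flow of pairs at `x`: the pairs
initially at `x`, minus the pair lost when passing an `s`-label whose two neighbors both hold an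
even number of particles. -/
def pairGain (η : ℤ → ℕ) (ζ : ℤ → Label) (x : ℤ) : ℤ :=
  (η x / 2 : ℕ) - if ζ (x - 1) = Label.s ∧ η (x - 2) % 2 = 0 ∧ η x % 2 = 0 then 1 else 0

/-- No two `s`-labels are within distance two of each other. -/
def Sparse (ζ : ℤ → Label) : Prop :=
  ∀ x : ℤ, ¬(ζ x = Label.s ∧ ζ (x + 1) = Label.s) ∧ ¬(ζ x = Label.s ∧ ζ (x + 2) = Label.s)

lemma Sparse.eq_r {ζ : ℤ → Label} (h : Sparse ζ) {x y : ℤ} (hx : ζ x = Label.s) (hne : y ≠ x)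
    (h1 : y ≤ x + 2) (h2 : x ≤ y + 2) : ζ y = Label.r := by
  rcases label_cases (ζ y) with hy | hy
  · exact hy
  exfalso
  obtain rfl | rfl | rfl | rfl : y = x + 1 ∨ y = x + 2 ∨ x = y + 1 ∨ x = y + 2 := by omega
  · exact (h x).1 ⟨hx, hy⟩
  · exact (h x).2 ⟨hx, hy⟩
  · exact (h y).1 ⟨hy, hx⟩
  · exact (h y).2 ⟨hy, hx⟩

lemma IsStabilizing.exists_flow {η : ℤ → ℕ} {ζ : ℤ → Label} {u : ℤ → ℕ} (hζ : Sparse ζ)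
    (hu : IsStabilizing η ζ u) :
    ∃ H : ℤ → ℤ, (∀ x, 0 ≤ H x) ∧ ∀ x, H (x - 1) + pairGain η ζ x ≤ H x := by
  refine ⟨fun x => if ζ (x + 1) = Label.s then u (x - 1) + (η x / 2 : ℕ)
    else if ζ x = Label.s then u (x - 2) + (η (x - 1) / 2 : ℕ) + (η x / 2 : ℕ) else u x,
    fun x => by positivity, fun x => ?_⟩
  have e0 : x - 1 - 1 = x - 2 := by ring
  have e1 : x - 2 - 1 = x - 3 := by ring
  have e2 : x - 1 + 1 = x := by ring
  have e3 : x - 2 + 1 = x - 1 := by ring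
  have e4 : x - 1 - 2 = x - 3 := by ring
  have h0 := hu x
  have h1 := hu (x - 1)
  have h2 := hu (x - 2)
  simp only [inflow, pairGain, e0, e1, e2, e3, e4] at h0 h1 h2 ⊢
  rcases label_cases (ζ (x + 1)) with hp | hp
  · rcases label_cases (ζ x) with hx | hx
    · rcases label_cases (ζ (x - 1)) with hm | hm
      · simp only [hp, hx, hm, reduceCtorEq, if_false, if_true, false_and] at h0 ⊢
        omega
      · have a1 := hζ.eq_r hm (y := x - 2) (by omega) (by omega) (by omega)
        have a2 := hζ.eq_r hm (y := x - 3) (by omega) (by omega) (by omega)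
        simp only [hp, hx, hm, a1, a2, reduceCtorEq, if_false, if_true, true_and] at h0 h1 h2 ⊢
        split_ifs <;> omega
    · have a1 := hζ.eq_r hx (y := x - 1) (by omega) (by omega) (by omega)
      simp only [hp, hx, a1, reduceCtorEq, if_false, if_true, false_and]
      omega
  · have a1 := hζ.eq_r hp (y := x) (by omega) (by omega) (by omega)
    have a2 := hζ.eq_r hp (y := x - 1) (by omega) (by omega) (by omega)
    simp only [hp, a1, a2, reduceCtorEq, if_false, if_true, false_and]
    omega

lemma exists_isStabilizing_of_flow {η : ℤ → ℕ} {ζ : ℤ → Label} (hζ : Sparse ζ) {H : ℤ → ℤ}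
    (hpos : ∀ x, 0 ≤ H x) (hH : ∀ x, H (x - 1) + pairGain η ζ x ≤ H x) :
    ∃ u, IsStabilizing η ζ u := by
  refine ⟨fun x => if ζ (x + 1) = Label.s then 2 * (H x + 1).toNat + η x % 2 + η (x + 1) / 2 - 1
    else if ζ x = Label.s then
      2 * (H (x - 1) + 1).toNat + η (x - 1) % 2 + 2 * (η x / 2) - 1
    else (H x + 1).toNat, fun x => ?_⟩
  have e0 : x - 1 - 1 = x - 2 := by ring
  have e2 : x - 1 + 1 = x := by ring
  have e4 : x + 1 - 1 = x := by ring
  have e5 : x + 1 + 1 = x + 2 := by ring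
  have h0 := hH x
  have h1 := hH (x - 1)
  have h2 := hH (x + 1)
  have p0 := hpos x
  have p1 := hpos (x - 1)
  have p2 := hpos (x - 2)
  have p3 := hpos (x + 1)
  have e6 : x - 1 - 2 = x - 3 := by ring
  have e7 : x + 1 - 2 = x - 1 := by ring
  simp only [inflow, pairGain, e0, e2, e4, e5, e6, e7] at h0 h1 h2 ⊢
  rcases label_cases (ζ (x + 1)) with hp | hp
  · rcases label_cases (ζ x) with hx | hx
    · rcases label_cases (ζ (x - 1)) with hm | hm
      · simp only [hp, hx, hm, reduceCtorEq, if_false, if_true, false_and] at h0 ⊢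
        omega
      · simp only [hp, hx, hm, reduceCtorEq, if_false, if_true, true_and] at h0 h1 ⊢
        have a1 := hζ.eq_r hm (y := x - 2) (by omega) (by omega) (by omega)
        simp only [a1, reduceCtorEq, if_false, false_and] at h1
        split_ifs at h0 <;> omega
    · have a1 := hζ.eq_r hx (y := x - 1) (by omega) (by omega) (by omega)
      simp only [hp, hx, a1, reduceCtorEq, if_false, if_true]
      omega
  · have a1 := hζ.eq_r hp (y := x) (by omega) (by omega) (by omega)
    have a2 := hζ.eq_r hp (y := x - 1) (by omega) (by omega) (by omega)
    have a3 := hζ.eq_r hp (y := x + 2) (by omega) (by omega) (by omega)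
    simp only [hp, a1, a2, a3, reduceCtorEq, if_false, if_true, false_and] at h0 ⊢
    omega

open Finset in
lemma bddAbove_sum_succ_iff (g : ℤ → ℤ) (y : ℤ) :
    BddAbove (Set.range fun n : ℕ => ∑ i ∈ range n, g (y + 1 - i)) ↔
      BddAbove (Set.range fun n : ℕ => ∑ i ∈ range n, g (y - i)) := by
  have key (n : ℕ) :
      ∑ i ∈ range (n + 1), g (y + 1 - i) = g (y + 1) + ∑ i ∈ range n, g (y - i) := by
    rw [sum_range_succ', add_comm]
    congr 1
    · simp
    · refine sum_congr rfl fun i _ => ?_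
      push_cast
      congr 1
      ring
  constructor
  · rintro ⟨K, hK⟩
    refine ⟨K - g (y + 1), ?_⟩
    rintro _ ⟨n, rfl⟩
    have := hK ⟨n + 1, rfl⟩
    simp only [key] at this
    linarith
  · rintro ⟨K, hK⟩
    refine ⟨max 0 (g (y + 1) + K), ?_⟩
    rintro _ ⟨n, rfl⟩
    cases n with
    | zero => simp
    | succ n =>
      have := hK ⟨n, rfl⟩
      simp only [key] at this ⊢
      exact le_max_of_le_right (by linarith)

open Finset in
lemma bddAbove_sum_iff (g : ℤ → ℤ) (y z : ℤ) :
    BddAbove (Set.range fun n : ℕ => ∑ i ∈ range n, g (y - i)) ↔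
      BddAbove (Set.range fun n : ℕ => ∑ i ∈ range n, g (z - i)) := by
  suffices h : ∀ y : ℤ, BddAbove (Set.range fun n : ℕ => ∑ i ∈ range n, g (y - i)) ↔
      BddAbove (Set.range fun n : ℕ => ∑ i ∈ range n, g (0 - i)) from (h y).trans (h z).symm
  intro y
  induction y using Int.induction_on with
  | zero => rfl
  | succ k ih => exact (bddAbove_sum_succ_iff g k).trans ih
  | pred k ih =>
    have := bddAbove_sum_succ_iff g (-k - 1)
    rw [sub_add_cancel] at this
    exact this.symm.trans ih

open Finset in
lemma exists_flow_iff (g : ℤ → ℤ) :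
    (∃ H : ℤ → ℤ, (∀ x, 0 ≤ H x) ∧ ∀ x, H (x - 1) + g x ≤ H x) ↔
      BddAbove (Set.range fun n : ℕ => ∑ i ∈ range n, g (0 - i)) := by
  constructor
  · rintro ⟨H, hpos, hH⟩
    refine ⟨H 0, ?_⟩
    rintro _ ⟨n, rfl⟩
    have key : ∑ i ∈ range n, g (0 - i) + H (0 - n) ≤ H 0 := by
      induction n with
      | zero => simp
      | succ n ih =>
        have h := hH (0 - n)
        rw [sum_range_succ]
        push_cast
        rw [show (0 : ℤ) - (n + 1) = 0 - n - 1 by ring]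
        linarith
    have := hpos (0 - n)
    simp only
    linarith
  · intro hb
    have hb (y : ℤ) := (bddAbove_sum_iff g y 0).2 hb
    refine ⟨fun x => ⨆ n : ℕ, ∑ i ∈ range n, g (x - i), fun x => ?_, fun x => ?_⟩
    · exact (by simp : (0 : ℤ) ≤ ∑ i ∈ range 0, g (x - i)).trans (le_ciSup (hb x) 0)
    · rw [← le_sub_iff_add_le]
      refine ciSup_le fun n => ?_
      rw [le_sub_iff_add_le]
      refine le_trans (le_of_eq ?_) (le_ciSup (hb x) (n + 1))
      rw [sum_range_succ']
      congr 1
      · refine sum_congr rfl fun i _ => ?_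
        push_cast
        congr 1
        ring
      · simp

lemma stabilizable_iff {η : ℤ → ℕ} {ζ : ℤ → Label} (hζ : Sparse ζ) :
    Stabilizable η ζ ↔
      BddAbove (Set.range fun n : ℕ => ∑ i ∈ Finset.range n, pairGain η ζ (0 - i)) := by
  rw [stabilizable_iff_exists_isStabilizing, ← exists_flow_iff]
  constructor
  · rintro ⟨u, hu⟩
    exact hu.exists_flow hζ
  · rintro ⟨H, hpos, hH⟩
    exact exists_isStabilizing_of_flow hζ hpos hH

section Ergodic

variable {Ω : Type*} [MeasurableSpace Ω] {P : Measure Ω} {T : Ω → Ω} {d : Ω → ℝ}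

/-- The maximum of the first `n + 1` Birkhoff sums of `d`. -/
noncomputable def maxSum (T : Ω → Ω) (d : Ω → ℝ) : ℕ → Ω → ℝ
  | 0, _ => 0
  | n + 1, ω => max 0 (d ω + maxSum T d n (T ω))

omit [MeasurableSpace Ω] in
lemma maxSum_nonneg (n : ℕ) (ω : Ω) : 0 ≤ maxSum T d n ω := by
  cases n <;> simp [maxSum]

omit [MeasurableSpace Ω] in
lemma maxSum_le_succ (n : ℕ) (ω : Ω) : maxSum T d n ω ≤ maxSum T d (n + 1) ω := by
  induction n generalizing ω with
  | zero => exact maxSum_nonneg 1 ω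
  | succ n ih =>
    rw [maxSum, maxSum]
    exact max_le_max_left _ (by linarith [ih (T ω)])

omit [MeasurableSpace Ω] in
lemma birkhoffSum_le_maxSum (n : ℕ) (ω : Ω) : birkhoffSum T d n ω ≤ maxSum T d n ω := by
  induction n generalizing ω with
  | zero => simp [maxSum]
  | succ n ih =>
    rw [birkhoffSum_succ', maxSum]
    exact le_max_of_le_right (by linarith [ih (T ω)])

omit [MeasurableSpace Ω] in
lemma exists_maxSum_eq (n : ℕ) (ω : Ω) : ∃ k, maxSum T d n ω = birkhoffSum T d k ω := by
  induction n generalizing ω with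
  | zero => exact ⟨0, by simp [maxSum]⟩
  | succ n ih =>
    obtain ⟨k, hk⟩ := ih (T ω)
    rw [maxSum, hk, ← birkhoffSum_succ']
    rcases max_choice 0 (birkhoffSum T d (k + 1) ω) with h | h
    · exact ⟨0, by rw [h, birkhoffSum_zero]⟩
    · exact ⟨k + 1, h⟩

omit [MeasurableSpace Ω] in
lemma bddAbove_maxSum {ω : Ω} (h : BddAbove (Set.range fun n => birkhoffSum T d n ω)) :
    BddAbove (Set.range fun n => maxSum T d n ω) := by
  obtain ⟨K, hK⟩ := h
  refine ⟨K, ?_⟩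
  rintro _ ⟨n, rfl⟩
  obtain ⟨k, hk⟩ := exists_maxSum_eq (T := T) (d := d) n ω
  exact hk.trans_le (hK ⟨k, rfl⟩)

lemma measurable_maxSum (hT : Measurable T) (hd : Measurable d) (n : ℕ) :
    Measurable (maxSum T d n) := by
  induction n with
  | zero => exact measurable_const
  | succ n ih => exact measurable_const.max (hd.add (ih.comp hT))

lemma integrable_maxSum (hT : MeasurePreserving T P P) (hd : Integrable d P) (n : ℕ) :
    Integrable (maxSum T d n) P := by
  induction n with
  | zero => exact integrable_zero _ _ _
  | succ n ih =>
    exact (integrable_zero _ _ _).sup (hd.add ((hT.integrable_comp_of_integrable ih)))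

lemma integral_nonneg_of_ae_not_bddAbove (hT : MeasurePreserving T P P) (hdm : Measurable d)
    (hd : Integrable d P)
    (h : ∀ᵐ ω ∂P, ¬BddAbove (Set.range fun n => birkhoffSum T d n ω)) : 0 ≤ ∫ ω, d ω ∂P := by
  have hlim : Tendsto (fun n => ∫ ω, (maxSum T d (n + 1) ω - maxSum T d n (T ω)) ∂P) atTop
      (𝓝 (∫ ω, d ω ∂P)) := by
    refine tendsto_integral_of_dominated_convergence (fun ω => |d ω|) (fun n => ?_) hd.abs
      (fun n => ?_) ?_
    · exact ((measurable_maxSum hT.measurable hdm (n + 1)).sub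
        ((measurable_maxSum hT.measurable hdm n).comp hT.measurable)).aestronglyMeasurable
    · filter_upwards with ω
      have := maxSum_nonneg (T := T) (d := d) n (T ω)
      rw [Real.norm_eq_abs, maxSum, abs_le]
      constructor
      · linarith [le_max_right 0 (d ω + maxSum T d n (T ω)), neg_abs_le (d ω)]
      · linarith [max_le (a := 0) (b := d ω + maxSum T d n (T ω))
          (c := |d ω| + maxSum T d n (T ω)) (by positivity) (by linarith [le_abs_self (d ω)])]
    · filter_upwards [hT.quasiMeasurePreserving.ae h] with ω hω
      refine tendsto_const_nhds.congr' ?_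
      simp only [bddAbove_def, Set.mem_range, forall_exists_index, forall_apply_eq_imp_iff,
        not_exists, not_forall, not_le] at hω
      obtain ⟨n₀, hn₀⟩ := hω (-d ω)
      filter_upwards [eventually_ge_atTop n₀] with n hn
      have h1 : maxSum T d n₀ (T ω) ≤ maxSum T d n (T ω) :=
        monotone_nat_of_le_succ (f := fun n => maxSum T d n (T ω))
          (fun n => maxSum_le_succ n (T ω)) hn
      have h2 := birkhoffSum_le_maxSum (T := T) (d := d) n₀ (T ω)
      rw [maxSum, max_eq_right (by linarith)]
      ring
  refine ge_of_tendsto' hlim fun n => ?_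
  have hc : ∫ ω, maxSum T d n (T ω) ∂P = ∫ ω, maxSum T d n ω ∂P := by
    conv_rhs => rw [← hT.map_eq]
    exact (integral_map hT.measurable.aemeasurable
      (measurable_maxSum hT.measurable hdm n).aestronglyMeasurable).symm
  have hi : Integrable (fun ω => maxSum T d n (T ω)) P :=
    hT.integrable_comp_of_integrable (integrable_maxSum hT hd n)
  rw [integral_sub (integrable_maxSum hT hd _) hi, hc, sub_nonneg]
  exact integral_mono (integrable_maxSum hT hd n) (integrable_maxSum hT hd (n + 1))
    fun ω => maxSum_le_succ n ω

lemma integral_nonpos_of_ae_bddAbove [IsProbabilityMeasure P] (hT : MeasurePreserving T P P)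
    (hdm : Measurable d) (hd : Integrable d P)
    (h : ∀ᵐ ω ∂P, BddAbove (Set.range fun n => birkhoffSum T d n ω)) : ∫ ω, d ω ∂P ≤ 0 := by
  set H : Ω → ℝ := fun ω => ⨆ n, maxSum T d n ω with hHdef
  have hHm : Measurable H := Measurable.iSup fun n => measurable_maxSum hT.measurable hdm n
  have hH0 (ω : Ω) : 0 ≤ H ω := Real.iSup_nonneg fun n => maxSum_nonneg n ω
  have hHT : ∀ᵐ ω ∂P, H (T ω) + d ω ≤ H ω := by
    filter_upwards [h] with ω hω
    rw [← le_sub_iff_add_le]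
    refine ciSup_le fun n => ?_
    have h1 : maxSum T d (n + 1) ω ≤ H ω := le_ciSup (bddAbove_maxSum hω) (n + 1)
    rw [maxSum] at h1
    linarith [le_max_right 0 (d ω + maxSum T d n (T ω))]
  have hHint (K : ℕ) : Integrable (fun ω => min (H ω) K) P := by
    refine Integrable.of_bound (hHm.min measurable_const).aestronglyMeasurable (K : ℝ) ?_
    filter_upwards with ω
    rw [Real.norm_of_nonneg (le_min (hH0 ω) (by positivity))]
    exact min_le_right _ _
  have hHint' (K : ℕ) : Integrable (fun ω => min (H (T ω)) K) P :=
    hT.integrable_comp_of_integrable (hHint K)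
  have hbound (K : ℕ) (ω : Ω) :
      ‖min (H (T ω) + d ω) K - min (H (T ω)) K‖ ≤ |d ω| := by
    simpa using abs_min_sub_min_le_max (H (T ω) + d ω) (K : ℝ) (H (T ω)) K
  have hmeas (K : ℕ) : AEStronglyMeasurable
      (fun ω => min (H (T ω) + d ω) K - min (H (T ω)) K) P :=
    ((((hHm.comp hT.measurable).add hdm).min measurable_const).sub
      ((hHm.comp hT.measurable).min measurable_const)).aestronglyMeasurable
  have hlim : Tendsto (fun K : ℕ => ∫ ω, (min (H (T ω) + d ω) K - min (H (T ω)) K) ∂P) atTop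
      (𝓝 (∫ ω, d ω ∂P)) := by
    refine tendsto_integral_of_dominated_convergence (fun ω => |d ω|) hmeas hd.abs
      (fun K => ae_of_all _ (hbound K)) (ae_of_all _ fun ω => ?_)
    refine tendsto_const_nhds.congr' ?_
    filter_upwards [tendsto_natCast_atTop_atTop.eventually_ge_atTop (H (T ω) + |d ω|)] with K hK
    rw [min_eq_left (by linarith [le_abs_self (d ω)]), min_eq_left (by linarith [abs_nonneg (d ω)])]
    ring
  refine le_of_tendsto' hlim fun K => ?_
  calc ∫ ω, (min (H (T ω) + d ω) K - min (H (T ω)) K) ∂P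
      ≤ ∫ ω, (min (H ω) K - min (H (T ω)) K) ∂P := by
        refine integral_mono_ae (hd.abs.mono' (hmeas K) (ae_of_all _ (hbound K)))
          ((hHint K).sub (hHint' K)) ?_
        filter_upwards [hHT] with ω hω
        exact sub_le_sub_right (min_le_min_right _ hω) _
    _ = 0 := by
        have hc : ∫ ω, min (H (T ω)) K ∂P = ∫ ω, min (H ω) K ∂P := by
          conv_rhs => rw [← hT.map_eq]
          exact (integral_map hT.measurable.aemeasurable
            (hHm.min measurable_const).aestronglyMeasurable).symm
        rw [integral_sub (hHint K) (hHint' K), hc, sub_self]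

end Ergodic

lemma eq_infinitePi_of_singleton {m : Measure (ℤ → ℕ)} {q : Measure ℕ} [IsProbabilityMeasure m]
    [IsProbabilityMeasure q]
    (h : ∀ (S : Finset ℤ) (k : ℤ → ℕ), m {η | ∀ x ∈ S, η x = k x} = ∏ x ∈ S, q {k x}) :
    m = Measure.infinitePi fun _ => q := by
  refine IsProjectiveLimit.unique (fun S => ?_) (Measure.isProjectiveLimit_infinitePi _)
  refine Measure.ext_of_singleton fun k => ?_
  rw [Measure.pi_singleton, Measure.map_apply (by fun_prop) (measurableSet_singleton k)]
  let k' : ℤ → ℕ := fun x => if hx : x ∈ S then k ⟨x, hx⟩ else 0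
  have hk (x : S) : k' x = k x := by simp [k']
  have hset : (S.restrict : (ℤ → ℕ) → S → ℕ) ⁻¹' ({k} : Set (S → ℕ))
      = {η | ∀ x ∈ S, η x = k' x} := by
    ext η
    simp only [Set.mem_preimage, Set.mem_singleton_iff, funext_iff, Finset.restrict,
      Set.mem_ofPred_eq]
    exact ⟨fun h x hx => (h ⟨x, hx⟩).trans (hk ⟨x, hx⟩).symm, fun h x => (h x x.2).trans (hk x)⟩
  rw [hset, h, ← Finset.prod_coe_sort]
  exact Finset.prod_congr rfl fun x _ => by rw [hk]

/-- Translation of a configuration by one site to the right. -/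
def shiftRight {α : Type*} (f : ℤ → α) : ℤ → α := fun x => f (x - 1)

lemma measurePreserving_shiftRight_infinitePi {α : Type*} [MeasurableSpace α] (q : Measure α)
    [IsProbabilityMeasure q] :
    MeasurePreserving shiftRight (Measure.infinitePi fun _ : ℤ => q)
      (Measure.infinitePi fun _ : ℤ => q) where
  measurable := measurable_pi_lambda _ fun _ => measurable_pi_apply _
  map_eq := Measure.map_infinitePi_infinitePi_of_inj (P := fun _ : ℤ => q)
    (sub_left_injective (b := (1 : ℤ)))

lemma measurePreserving_shiftRight {α : Type*} [MeasurableSpace α] {ν : Measure (ℤ → α)}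
    (h : MeasurePreserving (fun (ζ : ℤ → α) x => ζ (x + 1)) ν ν) :
    MeasurePreserving shiftRight ν ν := by
  have hm : Measurable (shiftRight : (ℤ → α) → ℤ → α) :=
    measurable_pi_lambda _ fun _ => measurable_pi_apply _
  refine ⟨hm, ?_⟩
  conv_lhs => rw [← h.map_eq]
  rw [Measure.map_map hm h.measurable]
  convert Measure.map_id
  ext f x
  simp [shiftRight]

/-- Joint translation of heights and labels by one site to the right. -/
def jointShift (p : (ℤ → ℕ) × (ℤ → Label)) : (ℤ → ℕ) × (ℤ → Label) :=
  Prod.map shiftRight shiftRight p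

lemma iterate_jointShift (n : ℕ) (p : (ℤ → ℕ) × (ℤ → Label)) :
    jointShift^[n] p = (fun x => p.1 (x - n), fun x => p.2 (x - n)) := by
  induction n with
  | zero => simp
  | succ n ih =>
    rw [Function.iterate_succ_apply', ih]
    refine Prod.ext (funext fun x => congrArg p.1 ?_) (funext fun x => congrArg p.2 ?_) <;>
      push_cast <;> ring

lemma birkhoffSum_pairGain (n : ℕ) (p : (ℤ → ℕ) × (ℤ → Label)) :
    birkhoffSum jointShift (fun p => (pairGain p.1 p.2 0 : ℝ)) n p
      = ((∑ i ∈ Finset.range n, pairGain p.1 p.2 (0 - i) : ℤ) : ℝ) := by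
  rw [birkhoffSum]
  push_cast
  refine Finset.sum_congr rfl fun i _ => ?_
  rw [iterate_jointShift]
  simp only [pairGain, show (0 : ℤ) - 1 - i = 0 - i - 1 by ring,
    show (0 : ℤ) - 2 - i = 0 - i - 2 by ring]

/-- Height and label configurations along which the flow of pairs stays finite. -/
def finiteFlow : Set ((ℤ → ℕ) × (ℤ → Label)) :=
  {p | BddAbove (Set.range fun n : ℕ => ∑ i ∈ Finset.range n, pairGain p.1 p.2 (0 - i))}

lemma mem_finiteFlow_iff_birkhoffSum (p : (ℤ → ℕ) × (ℤ → Label)) :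
    p ∈ finiteFlow ↔ BddAbove (Set.range fun n =>
      birkhoffSum jointShift (fun p => (pairGain p.1 p.2 0 : ℝ)) n p) := by
  simp only [birkhoffSum_pairGain, finiteFlow, Set.mem_ofPred_eq, bddAbove_def, Set.mem_range,
    forall_exists_index, forall_apply_eq_imp_iff]
  constructor
  · rintro ⟨K, hK⟩
    exact ⟨K, fun n => by exact_mod_cast hK n⟩
  · rintro ⟨K, hK⟩
    exact ⟨⌊K⌋, fun n => Int.le_floor.2 (hK n)⟩

lemma measurableSet_bddAbove_sum {Ω : Type*} [MeasurableSpace Ω] {f : ℕ → Ω → ℤ}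
    (hf : ∀ i, Measurable (f i)) :
    MeasurableSet {ω | BddAbove (Set.range fun n : ℕ => ∑ i ∈ Finset.range n, f i ω)} :=
  measurableSet_bddAbove_range fun _ => Finset.measurable_fun_sum _ fun i _ => hf i

lemma measurable_pairGain (x : ℤ) :
    Measurable fun p : (ℤ → ℕ) × (ℤ → Label) => pairGain p.1 p.2 x := by
  have h : Measurable fun p : (ℤ → ℕ) × (ℤ → Label) =>
      (p.1 x, p.1 (x - 2), decide (p.2 (x - 1) = Label.s)) := by
    refine Measurable.prodMk (by fun_prop) (Measurable.prodMk (by fun_prop) ?_)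
    exact (measurable_from_top (f := fun l : Label => decide (l = Label.s))).comp (by fun_prop)
  have h2 := (Measurable.of_discrete (f := fun a : ℕ × ℕ × Bool =>
    ((a.1 / 2 : ℕ) : ℤ) - if a.2.2 = true ∧ a.2.1 % 2 = 0 ∧ a.1 % 2 = 0 then 1 else 0)).comp h
  simpa [Function.comp_def, pairGain] using! h2

lemma measurableSet_finiteFlow : MeasurableSet finiteFlow :=
  measurableSet_bddAbove_sum fun i => measurable_pairGain (0 - i)

lemma measure_finiteFlow_section_eq_zero_or_one (q : Measure ℕ) [IsProbabilityMeasure q]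
    (ζ : ℤ → Label) :
    (Measure.infinitePi fun _ : ℤ => q) {η | (η, ζ) ∈ finiteFlow} = 0 ∨
      (Measure.infinitePi fun _ : ℤ => q) {η | (η, ζ) ∈ finiteFlow} = 1 := by
  let s : ℤ → MeasurableSpace (ℤ → ℕ) := fun x => MeasurableSpace.comap (fun η => η x) inferInstance
  have hind : ProbabilityTheory.iIndep s (Measure.infinitePi fun _ : ℤ => q) :=
    (ProbabilityTheory.iIndepFun_infinitePi (X := fun _ : ℤ => (id : ℕ → ℕ))
      fun _ => measurable_id).iIndep
  refine ProbabilityTheory.measure_zero_or_one_of_measurableSet_limsup_atBot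
    (fun x => (measurable_pi_apply x).comap_le) hind ?_
  have hlim : limsup s atBot = ⨅ x, ⨆ y ∈ Set.Iic x, s y := by
    rw [atBot_basis.limsup_eq_iInf_iSup]
    simp
  rw [hlim, MeasurableSpace.measurableSet_iInf]
  intro x
  have hset : {η | (η, ζ) ∈ finiteFlow}
      = {η | BddAbove (Set.range fun n : ℕ => ∑ i ∈ Finset.range n, pairGain η ζ (x - i))} :=
    Set.ext fun η => bddAbove_sum_iff (pairGain η ζ) 0 x
  rw [hset]
  let : MeasurableSpace (ℤ → ℕ) := ⨆ y ∈ Set.Iic x, s y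
  have hcoord (y : ℤ) (hy : y ≤ x) : Measurable fun η : ℤ → ℕ => η y :=
    (comap_measurable _).mono (le_iSup₂_of_le y hy le_rfl) le_rfl
  refine measurableSet_bddAbove_sum fun i => ?_
  exact (Measurable.of_discrete (f := fun a : ℕ × ℕ =>
    ((a.1 / 2 : ℕ) : ℤ) - if ζ (x - i - 1) = Label.s ∧ a.2 % 2 = 0 ∧ a.1 % 2 = 0 then 1 else 0)).comp
    ((hcoord (x - i) (by omega)).prodMk (hcoord (x - i - 2) (by omega)))

lemma mem_finiteFlow_shift_iff (η : ℤ → ℕ) (ζ : ℤ → Label) :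
    (η, fun x => ζ (x + 1)) ∈ finiteFlow ↔ (shiftRight η, ζ) ∈ finiteFlow := by
  have key (i : ℕ) : pairGain η (fun x => ζ (x + 1)) (0 - i)
      = pairGain (shiftRight η) ζ (1 - i) := by
    simp only [pairGain, shiftRight, show (1 : ℤ) - i - 1 = 0 - i by ring,
      show (1 : ℤ) - i - 2 - 1 = 0 - i - 2 by ring, show (0 : ℤ) - i - 1 + 1 = 0 - i by ring]
  refine Iff.trans ?_ (bddAbove_sum_iff (pairGain (shiftRight η) ζ) 1 0)
  simp only [finiteFlow, Set.mem_ofPred_eq, key]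

lemma ae_mem_or_ae_notMem_finiteFlow (q : Measure ℕ) [IsProbabilityMeasure q]
    {ν : Measure (ℤ → Label)} [IsProbabilityMeasure ν]
    (hν : Ergodic (fun (ζ : ℤ → Label) x => ζ (x + 1)) ν) :
    (∀ᵐ p ∂(Measure.infinitePi fun _ : ℤ => q).prod ν, p ∈ finiteFlow) ∨
      ∀ᵐ p ∂(Measure.infinitePi fun _ : ℤ => q).prod ν, p ∉ finiteFlow := by
  set m := Measure.infinitePi fun _ : ℤ => q with hm
  have hsec : Measurable fun ζ => m {η | (η, ζ) ∈ finiteFlow} :=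
    measurable_measure_prodMk_right measurableSet_finiteFlow
  have hA : MeasurableSet {ζ | m {η | (η, ζ) ∈ finiteFlow} = 1} :=
    hsec (measurableSet_singleton 1)
  have hmeas (ζ : ℤ → Label) : MeasurableSet {η | (η, ζ) ∈ finiteFlow} :=
    measurable_prodMk_right measurableSet_finiteFlow
  have hinv : (fun (ζ : ℤ → Label) x => ζ (x + 1)) ⁻¹' {ζ | m {η | (η, ζ) ∈ finiteFlow} = 1}
      = {ζ | m {η | (η, ζ) ∈ finiteFlow} = 1} := by
    ext ζ
    simp only [Set.mem_preimage, Set.mem_ofPred_eq, mem_finiteFlow_shift_iff]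
    rw [← (measurePreserving_shiftRight_infinitePi q).measure_preimage
      (hmeas ζ).nullMeasurableSet]
    rfl
  rcases hν.toPreErgodic.ae_mem_or_ae_notMem hA hinv with h | h
  · left
    rw [ae_iff, ← Set.compl_ofPred, Set.ofPred_mem_eq,
      Measure.prod_apply_symm measurableSet_finiteFlow.compl, lintegral_eq_zero_iff
      (measurable_measure_prodMk_right measurableSet_finiteFlow.compl)]
    filter_upwards [h] with ζ hζ
    exact (prob_compl_eq_zero_iff (hmeas ζ)).2 hζ
  · right
    rw [ae_iff]
    simp only [not_not, Set.ofPred_mem_eq]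
    rw [Measure.prod_apply_symm measurableSet_finiteFlow, lintegral_eq_zero_iff
      (measurable_measure_prodMk_right measurableSet_finiteFlow)]
    filter_upwards [h] with ζ hζ
    exact (measure_finiteFlow_section_eq_zero_or_one q ζ).resolve_right hζ

section Poisson

open ProbabilityTheory

variable (r : NNReal)

lemma hasSum_poisson_neg_one_pow :
    HasSum (fun n : ℕ => Real.exp (-r) * (r : ℝ) ^ n / n.factorial * (-1) ^ n)
      (Real.exp (-2 * r)) := by
  have h := (NormedSpace.expSeries_div_hasSum_exp (-(r : ℝ))).mul_left (Real.exp (-r))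
  rw [← Real.exp_eq_exp_ℝ, ← Real.exp_add, show -(r : ℝ) + -r = -2 * r by ring] at h
  convert! h using 2 with n
  rw [neg_pow (r : ℝ)]
  ring

lemma hasSum_poisson_id :
    HasSum (fun n : ℕ => Real.exp (-r) * (r : ℝ) ^ n / n.factorial * n) r := by
  rw [← hasSum_nat_add_iff' 1]
  have h := (hasSum_one_poissonMeasure r).mul_left (r : ℝ)
  simp only [Finset.range_one, Finset.sum_singleton, Nat.cast_zero, mul_zero, sub_zero]
  rw [mul_one] at h
  convert! h using 2 with n
  rw [Nat.factorial_succ]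
  push_cast
  field_simp
  ring

lemma integral_even_poissonMeasure :
    ∫ n : ℕ, (if n % 2 = 0 then (1 : ℝ) else 0) ∂poissonMeasure r
      = (1 + Real.exp (-2 * r)) / 2 := by
  rw [integral_poissonMeasure]
  have h := ((hasSum_one_poissonMeasure r).add (hasSum_poisson_neg_one_pow r)).div_const 2
  rw [← h.tsum_eq]
  refine tsum_congr fun n => ?_
  rcases Nat.even_or_odd n with hn | hn
  · rw [if_pos (Nat.even_iff.1 hn), hn.neg_one_pow, smul_eq_mul]
    ring
  · rw [if_neg (by have := Nat.odd_iff.1 hn; omega), hn.neg_one_pow, smul_eq_mul]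
    ring

lemma hasSum_poisson_half :
    HasSum (fun n : ℕ => Real.exp (-r) * (r : ℝ) ^ n / n.factorial * ((n / 2 : ℕ) : ℝ))
      ((r - (1 - Real.exp (-2 * r)) / 2) / 2) := by
  have h := ((hasSum_poisson_id r).sub
    (((hasSum_one_poissonMeasure r).sub (hasSum_poisson_neg_one_pow r)).div_const 2)).div_const 2
  convert! h using 2 with n
  obtain ⟨k, rfl | rfl⟩ := Nat.even_or_odd' n
  · rw [Nat.mul_div_cancel_left k two_pos, (even_two_mul k).neg_one_pow]
    push_cast
    ring
  · rw [show (2 * k + 1) / 2 = k by omega, (odd_two_mul_add_one k).neg_one_pow]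
    push_cast
    ring

lemma integral_half_poissonMeasure :
    ∫ n : ℕ, ((n / 2 : ℕ) : ℝ) ∂poissonMeasure r = (r - (1 - Real.exp (-2 * r)) / 2) / 2 := by
  rw [integral_poissonMeasure]
  exact (hasSum_poisson_half r).tsum_eq

lemma integrable_half_poissonMeasure :
    Integrable (fun n : ℕ => ((n / 2 : ℕ) : ℝ)) (poissonMeasure r) := by
  rw [integrable_poissonMeasure_iff]
  simpa using (hasSum_poisson_half r).summable

variable {ν : Measure (ℤ → Label)} [IsProbabilityMeasure ν]

omit [IsProbabilityMeasure ν] in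
lemma pairGain_zero_cast (p : (ℤ → ℕ) × (ℤ → Label)) :
    (pairGain p.1 p.2 0 : ℝ) = ((p.1 0 / 2 : ℕ) : ℝ)
      - ((if p.1 (-2) % 2 = 0 then (1 : ℝ) else 0) * (if p.1 0 % 2 = 0 then (1 : ℝ) else 0))
        * {ζ : ℤ → Label | ζ (-1) = Label.s}.indicator 1 p.2 := by
  simp only [pairGain, Set.indicator, Set.mem_ofPred_eq, zero_sub, Pi.one_apply]
  by_cases h1 : p.2 (-1) = Label.s <;> by_cases h2 : p.1 (-2) % 2 = 0 <;>
    by_cases h3 : p.1 0 % 2 = 0 <;>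
    simp only [h1, h2, h3, Int.cast_sub, Int.cast_natCast, if_true, if_false, and_true, and_false,
      Int.cast_one, Int.cast_zero, mul_one, mul_zero, and_self]

lemma measurable_pairGain_cast :
    Measurable fun p : (ℤ → ℕ) × (ℤ → Label) => (pairGain p.1 p.2 0 : ℝ) :=
  Measurable.of_discrete.comp (measurable_pairGain 0)

lemma measurableSet_label (x : ℤ) (l : Label) : MeasurableSet {ζ : ℤ → Label | ζ x = l} := by
  have h : Measurable fun ζ : ℤ → Label => ζ x := measurable_pi_apply x
  have hl : MeasurableSet ({l} : Set Label) := MeasurableSpace.measurableSet_top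
  exact h hl

lemma integral_evens_infinitePi :
    ∫ η : ℤ → ℕ, (if η (-2) % 2 = 0 then (1 : ℝ) else 0) * (if η 0 % 2 = 0 then (1 : ℝ) else 0)
        ∂Measure.infinitePi (fun _ : ℤ => poissonMeasure r)
      = ((1 + Real.exp (-2 * r)) / 2) ^ 2 := by
  have hmap := Measure.infinitePi_map_eval_prod (P := fun _ : ℤ => poissonMeasure r)
    (show (-2 : ℤ) ≠ 0 by decide)
  let g : ℕ → ℝ := fun n => if n % 2 = 0 then 1 else 0
  have h := integral_map (μ := Measure.infinitePi fun _ : ℤ => poissonMeasure r)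
    (φ := fun η : ℤ → ℕ => (η (-2), η 0)) (f := fun a : ℕ × ℕ => g a.1 * g a.2)
    (by fun_prop) (Measurable.of_discrete).aestronglyMeasurable
  rw [hmap, integral_prod_mul, integral_even_poissonMeasure] at h
  rw [sq]
  exact h.symm

lemma integral_half_infinitePi :
    ∫ η : ℤ → ℕ, ((η 0 / 2 : ℕ) : ℝ) ∂Measure.infinitePi (fun _ : ℤ => poissonMeasure r)
      = (r - (1 - Real.exp (-2 * r)) / 2) / 2 := by
  have h := integral_map (μ := Measure.infinitePi fun _ : ℤ => poissonMeasure r)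
    (φ := fun η : ℤ → ℕ => η 0) (f := fun n : ℕ => ((n / 2 : ℕ) : ℝ))
    (measurable_pi_apply (0 : ℤ)).aemeasurable (Measurable.of_discrete).aestronglyMeasurable
  have hmap := Measure.infinitePi_map_eval (fun _ : ℤ => poissonMeasure r) 0
  rw [← h, ← integral_half_poissonMeasure]
  exact congrArg (fun m => ∫ n : ℕ, ((n / 2 : ℕ) : ℝ) ∂m) hmap

lemma integrable_half_prod :
    Integrable (fun p : (ℤ → ℕ) × (ℤ → Label) => ((p.1 0 / 2 : ℕ) : ℝ))
      ((Measure.infinitePi fun _ : ℤ => poissonMeasure r).prod ν) := by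
  have h := ((measurePreserving_eval_infinitePi (fun _ : ℤ => poissonMeasure r) 0).comp
    (measurePreserving_fst (ν := ν))).integrable_comp_of_integrable
      (integrable_half_poissonMeasure r)
  exact h

lemma integrable_loss_prod :
    Integrable (fun p : (ℤ → ℕ) × (ℤ → Label) =>
      ((if p.1 (-2) % 2 = 0 then (1 : ℝ) else 0) * (if p.1 0 % 2 = 0 then (1 : ℝ) else 0))
        * {ζ : ℤ → Label | ζ (-1) = Label.s}.indicator 1 p.2)
      ((Measure.infinitePi fun _ : ℤ => poissonMeasure r).prod ν) := by
  refine Integrable.mul_prod (f := fun η : ℤ → ℕ =>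
    (if η (-2) % 2 = 0 then (1 : ℝ) else 0) * (if η 0 % 2 = 0 then (1 : ℝ) else 0)) ?_
    ((integrable_const 1).indicator (measurableSet_label (-1) Label.s))
  refine Integrable.of_bound (C := 1) ?_ (ae_of_all _ fun η => ?_)
  · have hp : Measurable fun η : ℤ → ℕ => (η (-2), η 0) := by fun_prop
    exact ((Measurable.of_discrete (f := fun a : ℕ × ℕ =>
      (if a.1 % 2 = 0 then (1 : ℝ) else 0) * (if a.2 % 2 = 0 then (1 : ℝ) else 0))).comp
        hp).aestronglyMeasurable
  · split_ifs <;> simp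

lemma integrable_pairGain :
    Integrable (fun p : (ℤ → ℕ) × (ℤ → Label) => (pairGain p.1 p.2 0 : ℝ))
      ((Measure.infinitePi fun _ : ℤ => poissonMeasure r).prod ν) := by
  simp only [pairGain_zero_cast]
  exact (integrable_half_prod r).sub (integrable_loss_prod r)

lemma integral_pairGain :
    ∫ p : (ℤ → ℕ) × (ℤ → Label), (pairGain p.1 p.2 0 : ℝ)
        ∂((Measure.infinitePi fun _ : ℤ => poissonMeasure r).prod ν)
      = (r - (1 - Real.exp (-2 * r)) / 2) / 2
        - ((1 + Real.exp (-2 * r)) / 2) ^ 2 * ν.real {ζ | ζ (-1) = Label.s} := by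
  simp only [pairGain_zero_cast]
  rw [integral_sub (integrable_half_prod r) (integrable_loss_prod r)]
  congr 1
  · rw [integral_fun_fst (fun η : ℤ → ℕ => ((η 0 / 2 : ℕ) : ℝ)), integral_half_infinitePi]
    simp
  · rw [integral_prod_mul (fun η : ℤ → ℕ =>
      (if η (-2) % 2 = 0 then (1 : ℝ) else 0) * (if η 0 % 2 = 0 then (1 : ℝ) else 0)),
      integral_evens_infinitePi, integral_indicator_one (measurableSet_label (-1) Label.s)]

end Poisson

/-- Twice the mean of `pairGain` at density `ρ` when the `s`-labels have density `c`. -/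
noncomputable def drift (c ρ : ℝ) : ℝ :=
  ρ - (1 / 2) * (1 - Real.exp (-2 * ρ)) - c / 2 * (1 + Real.exp (-2 * ρ)) ^ 2

lemma drift_strictMonoOn {c : ℝ} (hc : 0 < c) : StrictMonoOn (drift c) (Set.Ici 0) := by
  intro a ha b _ hab
  have ha : 0 ≤ a := ha
  have h1 : Real.exp (-2 * b) = Real.exp (-2 * a) * Real.exp (-(2 * (b - a))) := by
    rw [← Real.exp_add]
    ring_nf
  have h2 : 1 - 2 * (b - a) ≤ Real.exp (-(2 * (b - a))) := by
    linarith [Real.add_one_le_exp (-(2 * (b - a)))]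
  have h3 : Real.exp (-2 * a) ≤ 1 := Real.exp_le_one_iff.2 (by linarith)
  have h4 : Real.exp (-2 * b) < Real.exp (-2 * a) := Real.exp_lt_exp.2 (by linarith)
  have h5 := Real.exp_pos (-2 * b)
  have h6 : Real.exp (-2 * a) - Real.exp (-2 * b) ≤ 2 * (b - a) := by
    rw [h1]
    nlinarith [Real.exp_pos (-2 * a)]
  have h7 : c / 2 * (1 + Real.exp (-2 * b)) ^ 2 < c / 2 * (1 + Real.exp (-2 * a)) ^ 2 :=
    mul_lt_mul_of_pos_left (by gcongr) (by linarith)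
  unfold drift
  linarith

lemma exists_drift_eq_zero {c : ℝ} (hc : 0 < c) (hc1 : c ≤ 1) : ∃ ρ, 0 < ρ ∧ drift c ρ = 0 := by
  have hcont : ContinuousOn (drift c) (Set.Icc 0 3) := by
    unfold drift
    fun_prop
  have h0 : drift c 0 < 0 := by
    simp only [drift, mul_zero, Real.exp_zero]
    linarith
  have h3 : 0 ≤ drift c 3 := by
    unfold drift
    have h1 : Real.exp (-2 * 3) ≤ 1 := Real.exp_le_one_iff.2 (by norm_num)
    have h2 := Real.exp_pos (-2 * 3)
    generalize Real.exp (-2 * 3) = e at h1 h2 ⊢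
    have h4 : (1 + e) ^ 2 ≤ 4 := by nlinarith
    have h5 : c / 2 * (1 + e) ^ 2 ≤ 1 / 2 * 4 :=
      mul_le_mul (by linarith) h4 (by positivity) (by norm_num)
    linarith
  obtain ⟨ρ, hρ, hz⟩ := intermediate_value_Icc (by norm_num) hcont ⟨h0.le, h3⟩
  refine ⟨ρ, lt_of_le_of_ne hρ.1 ?_, hz⟩
  rintro rfl
  exact h0.ne hz

section Phases

variable {ν : Measure (ℤ → Label)} [IsProbabilityMeasure ν] {m : Measure (ℤ → ℕ)}
  [IsProbabilityMeasure m] {ρ : ℝ}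

lemma measurePreserving_jointShift (q : Measure ℕ) [IsProbabilityMeasure q]
    (hν : MeasurePreserving (fun (ζ : ℤ → Label) x => ζ (x + 1)) ν ν) :
    MeasurePreserving jointShift ((Measure.infinitePi fun _ : ℤ => q).prod ν)
      ((Measure.infinitePi fun _ : ℤ => q).prod ν) :=
  (measurePreserving_shiftRight_infinitePi q).prod (measurePreserving_shiftRight hν)

lemma eq_infinitePi_poissonMeasure (hρ : 0 < ρ)
    (hm : ∀ (S : Finset ℤ) (k : ℤ → ℕ), m {η | ∀ x ∈ S, η x = k x}
      = ∏ x ∈ S, ENNReal.ofReal (Real.exp (-ρ) * ρ ^ k x / (k x).factorial)) :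
    m = Measure.infinitePi fun _ : ℤ => ProbabilityTheory.poissonMeasure ρ.toNNReal := by
  refine eq_infinitePi_of_singleton fun S k => ?_
  rw [hm]
  refine Finset.prod_congr rfl fun x _ => ?_
  rw [ProbabilityTheory.poissonMeasure_singleton, Real.coe_toNNReal ρ hρ.le]

lemma integral_pairGain_eq_drift (hρ : 0 < ρ)
    (hν : MeasurePreserving (fun (ζ : ℤ → Label) x => ζ (x + 1)) ν ν) :
    ∫ p : (ℤ → ℕ) × (ℤ → Label), (pairGain p.1 p.2 0 : ℝ)
        ∂((Measure.infinitePi fun _ : ℤ => ProbabilityTheory.poissonMeasure ρ.toNNReal).prod ν)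
      = drift (ν.real {ζ | ζ 0 = Label.s}) ρ / 2 := by
  have h : ν.real {ζ | ζ (-1) = Label.s} = ν.real {ζ | ζ 0 = Label.s} := by
    rw [measureReal_def, measureReal_def,
      ← hν.measure_preimage (measurableSet_label (-1) Label.s).nullMeasurableSet]
    rfl
  rw [integral_pairGain, Real.coe_toNNReal ρ hρ.le, h, drift]
  ring

omit [IsProbabilityMeasure ν] in
lemma ae_stabilizable_iff (hρ : 0 < ρ)
    (hm : ∀ (S : Finset ℤ) (k : ℤ → ℕ), m {η | ∀ x ∈ S, η x = k x}
      = ∏ x ∈ S, ENNReal.ofReal (Real.exp (-ρ) * ρ ^ k x / (k x).factorial))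
    (hsparse : ∀ᵐ ζ ∂ν, Sparse ζ) :
    (∀ᵐ p ∂(m.prod ν), Stabilizable p.1 p.2) ↔
      ∀ᵐ p ∂((Measure.infinitePi fun _ : ℤ =>
        ProbabilityTheory.poissonMeasure ρ.toNNReal).prod ν), p ∈ finiteFlow := by
  rw [← eq_infinitePi_poissonMeasure hρ hm]
  refine eventually_congr ?_
  filter_upwards [Measure.quasiMeasurePreserving_snd.ae hsparse] with p hp
  exact stabilizable_iff hp

lemma drift_nonpos_of_ae_stabilizable (hρ : 0 < ρ)
    (hm : ∀ (S : Finset ℤ) (k : ℤ → ℕ), m {η | ∀ x ∈ S, η x = k x}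
      = ∏ x ∈ S, ENNReal.ofReal (Real.exp (-ρ) * ρ ^ k x / (k x).factorial))
    (hν : MeasurePreserving (fun (ζ : ℤ → Label) x => ζ (x + 1)) ν ν)
    (hsparse : ∀ᵐ ζ ∂ν, Sparse ζ) (h : ∀ᵐ p ∂(m.prod ν), Stabilizable p.1 p.2) :
    drift (ν.real {ζ | ζ 0 = Label.s}) ρ ≤ 0 := by
  rw [ae_stabilizable_iff hρ hm hsparse] at h
  have := integral_nonpos_of_ae_bddAbove (measurePreserving_jointShift _ hν)
    measurable_pairGain_cast (integrable_pairGain ρ.toNNReal)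
    (h.mono fun p hp => (mem_finiteFlow_iff_birkhoffSum p).1 hp)
  rw [integral_pairGain_eq_drift hρ hν] at this
  linarith

lemma ae_stabilizable_of_drift_neg (hρ : 0 < ρ)
    (hm : ∀ (S : Finset ℤ) (k : ℤ → ℕ), m {η | ∀ x ∈ S, η x = k x}
      = ∏ x ∈ S, ENNReal.ofReal (Real.exp (-ρ) * ρ ^ k x / (k x).factorial))
    (hν : Ergodic (fun (ζ : ℤ → Label) x => ζ (x + 1)) ν)
    (hsparse : ∀ᵐ ζ ∂ν, Sparse ζ) (h : drift (ν.real {ζ | ζ 0 = Label.s}) ρ < 0) :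
    ∀ᵐ p ∂(m.prod ν), Stabilizable p.1 p.2 := by
  rw [ae_stabilizable_iff hρ hm hsparse]
  refine (ae_mem_or_ae_notMem_finiteFlow _ hν).resolve_right fun hnot => ?_
  have := integral_nonneg_of_ae_not_bddAbove
    (measurePreserving_jointShift _ hν.toMeasurePreserving)
    measurable_pairGain_cast (integrable_pairGain ρ.toNNReal)
    (hnot.mono fun p hp => fun hb => hp ((mem_finiteFlow_iff_birkhoffSum p).2 hb))
  rw [integral_pairGain_eq_drift hρ hν.toMeasurePreserving] at this
  linarith

end Phases

end Sandpile

/-- Theorem 2.2(b): let `ν` be a shift-invariant ergodic measure on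
`{r,s}^ℤ`, almost surely with no two `s`-labels within distance `2`, giving positive
probability to `ζ 0 = s`, and let `μ ρ` be the product measure with i.i.d. Poisson(`ρ`)
marginals.  Then the transition density
`ρ_tr = sup {ρ > 0 | (η,ζ) is μ_ρ ⊗ ν-a.s. stabilizable}` is the unique positive
solution of `ρ - (1/2)(1 - e^{-2ρ}) = ((1 - f_r)/2)(1 + e^{-2ρ})²`, where
`f_r = ν(ζ 0 = r)`. -/
theorem transition_density_restricted
    (ν : Measure (ℤ → Label)) [IsProbabilityMeasure ν]
    (hshift : Ergodic (fun ζ : ℤ → Label => fun x => ζ (x + 1)) ν)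
    (hrestr : ∀ᵐ ζ ∂ν, ∀ x : ℤ,
      ¬(ζ x = Label.s ∧ ζ (x + 1) = Label.s) ∧
      ¬(ζ x = Label.s ∧ ζ (x + 2) = Label.s))
    (hs : 0 < ν {ζ | ζ 0 = Label.s})
    (μ : ℝ → Measure (ℤ → ℕ))
    (hμprob : ∀ ρ : ℝ, 0 < ρ → IsProbabilityMeasure (μ ρ))
    (hμ : ∀ ρ : ℝ, 0 < ρ → ∀ (S : Finset ℤ) (k : ℤ → ℕ),
      μ ρ {η | ∀ x ∈ S, η x = k x}
        = ∏ x ∈ S, ENNReal.ofReal (Real.exp (-ρ) * ρ ^ k x / (k x).factorial))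
    (fr : ℝ) (hfr : fr = (ν {ζ | ζ 0 = Label.r}).toReal)
    (ρtr : ℝ)
    (hρtr : ρtr = sSup {ρ : ℝ | 0 < ρ ∧
      ∀ᵐ p ∂((μ ρ).prod ν), Stabilizable p.1 p.2}) :
    (0 < ρtr ∧
      ρtr - (1 / 2) * (1 - Real.exp (-2 * ρtr))
        = ((1 - fr) / 2) * (1 + Real.exp (-2 * ρtr)) ^ 2) ∧
    ∀ ρ : ℝ, 0 < ρ →
      ρ - (1 / 2) * (1 - Real.exp (-2 * ρ))
        = ((1 - fr) / 2) * (1 + Real.exp (-2 * ρ)) ^ 2 → ρ = ρtr := by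
  set c := ν.real {ζ | ζ 0 = Label.s} with hc
  have hc0 : 0 < c := ENNReal.toReal_pos hs.ne' (measure_ne_top _ _)
  have hfc : 1 - fr = c := by
    have hcompl : {ζ : ℤ → Label | ζ 0 = Label.r}ᶜ = {ζ | ζ 0 = Label.s} := by
      ext ζ
      rcases Sandpile.label_cases (ζ 0) with h | h <;> simp [h]
    rw [hfr, hc, ← hcompl, probReal_compl_eq_one_sub (Sandpile.measurableSet_label 0 Label.r)]
    rfl
  have heq (ρ : ℝ) : (ρ - (1 / 2) * (1 - Real.exp (-2 * ρ))
      = ((1 - fr) / 2) * (1 + Real.exp (-2 * ρ)) ^ 2) ↔ Sandpile.drift c ρ = 0 := by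
    rw [hfc, Sandpile.drift, sub_eq_zero]
  have hmono := Sandpile.drift_strictMonoOn hc0
  obtain ⟨ρc, hρc, hz⟩ := Sandpile.exists_drift_eq_zero hc0 measureReal_le_one
  have htr : ρtr = ρc := by
    rw [hρtr]
    have hmem (ρ : ℝ) (hρ : 0 < ρ) (hlt : ρ < ρc) :
        0 < ρ ∧ ∀ᵐ p ∂((μ ρ).prod ν), Stabilizable p.1 p.2 := by
      have := hμprob ρ hρ
      exact ⟨hρ, Sandpile.ae_stabilizable_of_drift_neg hρ (hμ ρ hρ) hshift hrestr
        (hz ▸ hmono hρ.le hρc.le hlt)⟩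
    refine csSup_eq_of_forall_le_of_forall_lt_exists_gt
      ⟨ρc / 2, hmem _ (half_pos hρc) (half_lt_self hρc)⟩ ?_ fun w hw => ?_
    · rintro ρ ⟨hρ, hstab⟩
      have := hμprob ρ hρ
      have hle := Sandpile.drift_nonpos_of_ae_stabilizable hρ (hμ ρ hρ)
        hshift.toMeasurePreserving hrestr hstab
      rw [← hz] at hle
      exact (hmono.le_iff_le hρ.le hρc.le).1 hle
    · have hlt : max w 0 < ρc := max_lt hw hρc
      obtain ⟨ρ, h1, h2⟩ := exists_between hlt
      exact ⟨ρ, hmem ρ ((le_max_right w 0).trans_lt h1) h2, (le_max_left w 0).trans_lt h1⟩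
  simp only [heq]
  rw [htr]
  exact ⟨⟨hρc, hz⟩, fun ρ hρ h => hmono.injOn hρ.le hρc.le (h.trans hz.symm)⟩
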